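/- arXiv:2403.10372 — 2 statements merged into one kernel-verified Lean document; each statement's English description precedes it below -/
import Mathlib

section
/- Let F be a finite field of characteristic 2 with q = 2^m elements. The number of 3×3 matrices M over F that are MDS but not involutory (M² ≠ I) equals (as an integer) (q−1)²·(q−2)·(q⁶ − 15q⁵ + 87q⁴ − 244q³ + 345q² − 238q + 67). -/
/-- A square matrix over a field is MDS if every square submatrix
(selected via injective row and column index maps, of any order `k ≥ 1`)
is nonsingular. -/
def IsMDS {F : Type*} [Field F] {n : ℕ} (M : Matrix (Fin n) (Fin n) F) : Prop :=
  ∀ (k : ℕ), 1 ≤ k → ∀ (f g : Fin k → Fin n), Function.Injective f → Function.Injective g →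
    (M.submatrix f g).det ≠ 0

open Matrix Finset

section

variable {F : Type*} [Field F]

theorem isMDS_scale_iff {n : ℕ} (M : Matrix (Fin n) (Fin n) F) {x y : Fin n → F}
    (hx : ∀ i, x i ≠ 0) (hy : ∀ j, y j ≠ 0) :
    IsMDS (Matrix.of fun i j => x i * (y j * M i j)) ↔ IsMDS M := by
  unfold IsMDS
  refine forall_congr' fun k => forall_congr' fun _ => forall_congr' fun f => forall_congr' fun g =>
    forall_congr' fun _ => forall_congr' fun _ => not_congr ?_
  have h : ((Matrix.of fun i j => x i * (y j * M i j)).submatrix f g).det =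
      (∏ i, x (f i)) * ((∏ j, y (g j)) * (M.submatrix f g).det) := by
    rw [← Matrix.det_mul_row, ← Matrix.det_mul_column]
    rfl
  rw [h]
  simp [Finset.prod_eq_zero_iff, hx, hy]

theorem isMDS_fin_three_iff (M : Matrix (Fin 3) (Fin 3) F) :
    IsMDS M ↔ (∀ i j, M i j ≠ 0) ∧
      (∀ i i' j j', i < i' → j < j' → M i j * M i' j' - M i j' * M i' j ≠ 0) ∧ M.det ≠ 0 := by
  constructor
  · intro h
    refine ⟨fun i j => ?_, fun i i' j j' hi hj => ?_, ?_⟩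
    · have := h 1 le_rfl ![i] ![j] (Function.injective_of_subsingleton _)
        (Function.injective_of_subsingleton _)
      rwa [Matrix.det_fin_one] at this
    · have := h 2 one_le_two ![i, i'] ![j, j']
        (by simp [Function.Injective, Fin.forall_fin_two, hi.ne, hi.ne'])
        (by simp [Function.Injective, Fin.forall_fin_two, hj.ne, hj.ne'])
      rwa [Matrix.det_fin_two] at this
    · simpa using h 3 (by norm_num) id id Function.injective_id Function.injective_id
  · rintro ⟨h₁, h₂, h₃⟩ k hk f g hf hg
    have hk3 : k ≤ 3 := by simpa using Fintype.card_le_of_injective f hf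
    interval_cases k
    · simpa using h₁ (f 0) (g 0)
    · rw [Matrix.det_fin_two]
      simp only [Matrix.submatrix_apply]
      have hf01 : f 0 ≠ f 1 := hf.ne (by decide)
      have hg01 : g 0 ≠ g 1 := hg.ne (by decide)
      rcases hf01.lt_or_gt with hi | hi <;> rcases hg01.lt_or_gt with hj | hj <;>
        have := h₂ _ _ _ _ hi hj <;> grind
    · let e := Equiv.ofBijective f (Finite.injective_iff_bijective.1 hf)
      let e' := Equiv.ofBijective g (Finite.injective_iff_bijective.1 hg)
      have h : M.submatrix f g = (M.submatrix e id).submatrix id e' := rfl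
      rw [h, Matrix.det_permute', Matrix.det_permute]
      rcases Int.units_eq_one_or (Equiv.Perm.sign e) with h | h <;>
        rcases Int.units_eq_one_or (Equiv.Perm.sign e') with h' | h' <;> simp [h, h', h₃]

theorem isMDS_normalized_iff (a b c d : F) :
    IsMDS !![1, 1, 1; 1, a, b; 1, c, d] ↔
      (a ≠ 0 ∧ a ≠ 1) ∧ (b ≠ 0 ∧ b ≠ 1 ∧ b ≠ a) ∧ (c ≠ 0 ∧ c ≠ 1 ∧ c ≠ a) ∧
      d ≠ 0 ∧ d ≠ 1 ∧ d ≠ b ∧ d ≠ c ∧ a * d ≠ b * c ∧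
        (a - 1) * (d - 1) ≠ (b - 1) * (c - 1) := by
  have hdet : (!![1, 1, 1; 1, a, b; 1, c, d]).det = (a - 1) * (d - 1) - (b - 1) * (c - 1) := by
    simp [Matrix.det_fin_three]
    ring
  rw [isMDS_fin_three_iff, hdet]
  simp [Fin.forall_fin_succ, sub_eq_zero, -not_or, -not_and]
  tauto

/-- Every MDS matrix of order three is, in a unique way, a row and column scaling of one whose
first row and first column consist of ones. -/
def mdsEquivNormalized :
    {M : Matrix (Fin 3) (Fin 3) F // IsMDS M} ≃
      (Fˣ × Fˣ × Fˣ × Fˣ × Fˣ) ×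
        {p : F × F × F × F // IsMDS !![1, 1, 1; 1, p.1, p.2.1; 1, p.2.2.1, p.2.2.2]} where
  toFun M :=
    have h := ((isMDS_fin_three_iff M.1).1 M.2).1
    ((Units.mk0 _ (h 0 0), Units.mk0 _ (h 1 0), Units.mk0 _ (h 2 0),
        Units.mk0 _ (div_ne_zero (h 0 1) (h 0 0)), Units.mk0 _ (div_ne_zero (h 0 2) (h 0 0))),
      ⟨(M.1 1 1 * M.1 0 0 / (M.1 1 0 * M.1 0 1), M.1 1 2 * M.1 0 0 / (M.1 1 0 * M.1 0 2),
        M.1 2 1 * M.1 0 0 / (M.1 2 0 * M.1 0 1), M.1 2 2 * M.1 0 0 / (M.1 2 0 * M.1 0 2)), by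
        rw [← isMDS_scale_iff _ (x := fun i => M.1 i 0) (y := fun j => M.1 0 j / M.1 0 0)
          (fun i => h i 0) (fun j => div_ne_zero (h 0 j) (h 0 0))]
        convert M.2 using 1
        ext i j
        have := h 0 0
        have := h 1 0
        have := h 2 0
        have := h 0 1
        have := h 0 2
        fin_cases i <;> fin_cases j <;> simp <;> field_simp⟩)
  invFun p :=
    ⟨Matrix.of fun i j => (![p.1.1, p.1.2.1, p.1.2.2.1] i : F) *
        ((![1, p.1.2.2.2.1, p.1.2.2.2.2] j : F) *
          !![1, 1, 1; 1, p.2.1.1, p.2.1.2.1; 1, p.2.1.2.2.1, p.2.1.2.2.2] i j),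
      (isMDS_scale_iff _ (by simp) (by simp)).2 p.2.2⟩
  left_inv M := by
    have h := ((isMDS_fin_three_iff M.1).1 M.2).1
    have := h 0 0
    have := h 1 0
    have := h 2 0
    have := h 0 1
    have := h 0 2
    ext i j
    fin_cases i <;> fin_cases j <;> simp <;> field_simp
  right_inv := by
    rintro ⟨⟨u, v, w, s, t⟩, ⟨a, b, c, d⟩, hp⟩
    ext <;> simp <;> field_simp

section Fintype

variable [Fintype F] [DecidableEq F]

theorem card_compl_eq {α : Type*} [Fintype α] [DecidableEq α] (s : Finset α) :
    (#sᶜ : ℤ) = Fintype.card α - #s := by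
  rw [Finset.card_compl, Nat.cast_sub (Finset.card_le_univ s)]

theorem card_compl_pair : (#({0, 1}ᶜ : Finset F) : ℤ) = Fintype.card F - 2 := by
  rw [card_compl_eq, Finset.card_pair zero_ne_one, Nat.cast_two]

theorem card_compl_triple {a : F} (h₀ : a ≠ 0) (h₁ : a ≠ 1) :
    (#({0, 1, a}ᶜ : Finset F) : ℤ) = Fintype.card F - 3 := by
  rw [card_compl_eq, Finset.card_eq_three.2 ⟨0, 1, a, zero_ne_one, h₀.symm, h₁.symm, rfl⟩]
  norm_num

theorem card_last_entry {a b c : F} (ha₀ : a ≠ 0) (ha₁ : a ≠ 1) (hb₀ : b ≠ 0) (hb₁ : b ≠ 1)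
    (hba : b ≠ a) (hc₀ : c ≠ 0) (hc₁ : c ≠ 1) (hca : c ≠ a) :
    (#{d : F | d ≠ 0 ∧ d ≠ 1 ∧ d ≠ b ∧ d ≠ c ∧ a * d ≠ b * c ∧
        (a - 1) * (d - 1) ≠ (b - 1) * (c - 1)} : ℤ) =
      Fintype.card F - 6 + (if c = b then 1 else 0) + (if c = a / b then 1 else 0) +
        (if c = 1 - (a - 1) / (b - 1) then 1 else 0) := by
  have ha' : a - 1 ≠ 0 := sub_ne_zero.2 ha₁
  have hb' : b - 1 ≠ 0 := sub_ne_zero.2 hb₁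
  obtain ⟨e, he⟩ : ∃ e, a * e = b * c := ⟨b * c / a, by field_simp⟩
  obtain ⟨f, hf⟩ : ∃ f, (a - 1) * (f - 1) = (b - 1) * (c - 1) :=
    ⟨1 + (b - 1) * (c - 1) / (a - 1), by field_simp; ring⟩
  have hset : ({d : F | d ≠ 0 ∧ d ≠ 1 ∧ d ≠ b ∧ d ≠ c ∧ a * d ≠ b * c ∧
        (a - 1) * (d - 1) ≠ (b - 1) * (c - 1)} : Finset F) = ({c, e, f, 0, 1, b} : Finset F)ᶜ := by
    ext d
    have h₁ : a * d = b * c ↔ d = e := by rw [← he, mul_right_inj' ha₀]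
    have h₂ : (a - 1) * (d - 1) = (b - 1) * (c - 1) ↔ d = f := by
      rw [← hf, mul_right_inj' ha', sub_left_inj]
    simp only [Finset.mem_filter, Finset.mem_univ, true_and, Finset.mem_compl, Finset.mem_insert,
      Finset.mem_singleton, ne_eq, h₁, h₂]
    tauto
  have he1 : c = a / b ↔ e = 1 := by
    rw [eq_div_iff hb₀, mul_comm, ← he, mul_eq_left₀ ha₀]
  have hf0 : c = 1 - (a - 1) / (b - 1) ↔ f = 0 := by
    have : c = 1 - (a - 1) / (b - 1) ↔ (b - 1) * (c - 1) = - (a - 1) := by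
      constructor
      · rintro rfl
        field_simp
        ring
      · intro h
        field_simp
        linear_combination h
    rw [this, ← hf, ← mul_neg_one, mul_right_inj' ha', sub_eq_neg_self]
  have he0 : e ≠ 0 := by grind
  have heb : e ≠ b := by grind
  have hf1 : f ≠ 1 := by grind
  have hfb : f ≠ b := by grind
  have hce : c ≠ e := by grind
  have hcf : c ≠ f := by grind
  have hef : e ≠ f := by
    rintro rfl
    have : (a - b) * (c - a) = 0 := by linear_combination he + a * (hf - he)
    grind
  rw [hset, card_compl_eq]
  simp only [he1, hf0]
  have h6 : #({c, e, f, 0, 1, b} : Finset F) = (if c = b then 0 else 1) +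
      ((if e = 1 then 0 else 1) + ((if f = 0 then 0 else 1) + 3)) := by
    rw [Finset.card_insert_eq_ite, Finset.card_insert_eq_ite, Finset.card_insert_eq_ite,
      Finset.card_eq_three.2 ⟨0, 1, b, zero_ne_one, hb₀.symm, hb₁.symm, rfl⟩]
    simp only [Finset.mem_insert, Finset.mem_singleton, hce, hcf, hc₀, hc₁, hef, he0, heb, hf1, hfb,
      false_or, or_false]
    split_ifs <;> rfl
  rw [h6]
  grind

theorem card_second_row {a b : F} (ha₀ : a ≠ 0) (ha₁ : a ≠ 1) (hb₀ : b ≠ 0) (hb₁ : b ≠ 1)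
    (hba : b ≠ a) :
    ∑ c ∈ ({0, 1, a}ᶜ : Finset F), (#{d : F | d ≠ 0 ∧ d ≠ 1 ∧ d ≠ b ∧ d ≠ c ∧ a * d ≠ b * c ∧
        (a - 1) * (d - 1) ≠ (b - 1) * (c - 1)} : ℤ) =
      (Fintype.card F : ℤ) ^ 2 - 9 * Fintype.card F + 21 := by
  have hb' : b - 1 ≠ 0 := sub_ne_zero.2 hb₁
  have h₁ : b ∈ ({0, 1, a}ᶜ : Finset F) := by simp [*]
  have h₂ : a / b ∈ ({0, 1, a}ᶜ : Finset F) := by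
    simp [div_eq_iff hb₀, *]
    grind
  have h₃ : 1 - (a - 1) / (b - 1) ∈ ({0, 1, a}ᶜ : Finset F) := by
    have h : (b - 1) * (1 - (a - 1) / (b - 1)) = b - a := by field_simp; ring
    generalize 1 - (a - 1) / (b - 1) = x at *
    simp
    grind
  calc
    _ = ∑ c ∈ ({0, 1, a}ᶜ : Finset F), ((Fintype.card F : ℤ) - 6 + (if c = b then 1 else 0) +
        (if c = a / b then 1 else 0) + (if c = 1 - (a - 1) / (b - 1) then 1 else 0)) := by
      refine Finset.sum_congr rfl fun c hc => ?_
      simp only [Finset.mem_compl, Finset.mem_insert, Finset.mem_singleton, not_or] at hc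
      exact card_last_entry ha₀ ha₁ hb₀ hb₁ hba hc.1 hc.2.1 hc.2.2
    _ = _ := by
      simp only [Finset.sum_add_distrib, Finset.sum_ite_eq', h₁, h₂, h₃, if_true,
        Finset.sum_const, nsmul_eq_mul, card_compl_triple ha₀ ha₁]
      ring

theorem card_normalized_mds :
    (Nat.card {p : F × F × F × F //
      IsMDS !![1, 1, 1; 1, p.1, p.2.1; 1, p.2.2.1, p.2.2.2]} : ℤ) =
      ((Fintype.card F : ℤ) - 2) * ((Fintype.card F : ℤ) - 3) *
        ((Fintype.card F : ℤ) ^ 2 - 9 * Fintype.card F + 21) := by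
  let e : {p : F × F × F × F // IsMDS !![1, 1, 1; 1, p.1, p.2.1; 1, p.2.2.1, p.2.2.2]} ≃
      (({0, 1}ᶜ : Finset F).sigma fun a => ({0, 1, a}ᶜ : Finset F).sigma fun b =>
        ({0, 1, a}ᶜ : Finset F).sigma fun c => ({d : F | d ≠ 0 ∧ d ≠ 1 ∧ d ≠ b ∧ d ≠ c ∧
          a * d ≠ b * c ∧ (a - 1) * (d - 1) ≠ (b - 1) * (c - 1)} : Finset F) :
            Finset ((_ : F) × (_ : F) × (_ : F) × F)) :=
    { toFun := fun p => ⟨⟨p.1.1, p.1.2.1, p.1.2.2.1, p.1.2.2.2⟩, by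
        simpa using (isMDS_normalized_iff _ _ _ _).1 p.2⟩
      invFun := fun p => ⟨⟨p.1.1, p.1.2.1, p.1.2.2.1, p.1.2.2.2⟩,
        (isMDS_normalized_iff _ _ _ _).2 (by simpa using p.2)⟩
      left_inv := fun _ => rfl
      right_inv := fun _ => rfl }
  rw [Nat.card_congr e, Nat.card_eq_fintype_card, Fintype.card_coe]
  simp only [Finset.card_sigma, Nat.cast_sum]
  calc
    _ = ∑ a ∈ ({0, 1}ᶜ : Finset F), ∑ b ∈ ({0, 1, a}ᶜ : Finset F),
        ((Fintype.card F : ℤ) ^ 2 - 9 * Fintype.card F + 21) := by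
      refine Finset.sum_congr rfl fun a ha => Finset.sum_congr rfl fun b hb => ?_
      simp only [Finset.mem_compl, Finset.mem_insert, Finset.mem_singleton, not_or] at ha hb
      exact card_second_row ha.1 ha.2 hb.1 hb.2.1 hb.2.2
    _ = ∑ a ∈ ({0, 1}ᶜ : Finset F), ((Fintype.card F : ℤ) - 3) *
        ((Fintype.card F : ℤ) ^ 2 - 9 * Fintype.card F + 21) := by
      refine Finset.sum_congr rfl fun a ha => ?_
      simp only [Finset.mem_compl, Finset.mem_insert, Finset.mem_singleton, not_or] at ha
      rw [Finset.sum_const, nsmul_eq_mul, card_compl_triple ha.1 ha.2]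
    _ = _ := by
      rw [Finset.sum_const, nsmul_eq_mul, card_compl_pair]
      ring

theorem card_units_eq : (Nat.card Fˣ : ℤ) = Fintype.card F - 1 := by
  rw [Nat.card_eq_fintype_card, Fintype.card_units, Nat.cast_sub Fintype.card_pos, Nat.cast_one]

theorem card_mds_fin_three :
    (Nat.card {M : Matrix (Fin 3) (Fin 3) F // IsMDS M} : ℤ) =
      ((Fintype.card F : ℤ) - 1) ^ 5 * (((Fintype.card F : ℤ) - 2) * ((Fintype.card F : ℤ) - 3) *
        ((Fintype.card F : ℤ) ^ 2 - 9 * Fintype.card F + 21)) := by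
  rw [Nat.card_congr mdsEquivNormalized]
  simp only [Nat.card_prod, Nat.cast_mul, card_normalized_mds, card_units_eq]
  ring

end Fintype

/-- The involution `1 + u vᵀ` with `u = (1, x, y)` and `v = (r, s / x, (r + s) / y)`. -/
def involution (x y r s : F) : Matrix (Fin 3) (Fin 3) F :=
  !![1 + r, s / x, (r + s) / y; x * r, 1 + s, x * (r + s) / y; y * r, y * s / x, 1 + (r + s)]

theorem involution_mul_self [CharP F 2] {x y : F} (hx : x ≠ 0) (hy : y ≠ 0) (r s : F) :
    involution x y r s * involution x y r s = 1 := by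
  have h2 : (2 : F) = 0 := CharTwo.two_eq_zero
  ext i j
  fin_cases i <;> fin_cases j <;> simp [involution, Matrix.mul_apply, Fin.sum_univ_three] <;>
    field_simp <;> grind

theorem isMDS_involution [CharP F 2] {x y r s : F} (hx : x ≠ 0) (hy : y ≠ 0) (hr₀ : r ≠ 0)
    (hr₁ : r ≠ 1) (hs₀ : s ≠ 0) (hs₁ : s ≠ 1) (hsr : s ≠ r) (hsr₁ : s ≠ r + 1) :
    IsMDS (involution x y r s) := by
  have h2 : (2 : F) = 0 := CharTwo.two_eq_zero
  have hr : 1 + r ≠ 0 := by grind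
  have hs : 1 + s ≠ 0 := by grind
  have ht : r + s ≠ 0 := by grind
  have ht' : 1 + (r + s) ≠ 0 := by grind
  rw [isMDS_fin_three_iff]
  refine ⟨?_, ?_, ?_⟩
  · simp [Fin.forall_fin_succ, involution, *]
  · simp [Fin.forall_fin_succ, involution]
    field_simp
    grind
  · intro h
    have := congrArg Matrix.det (involution_mul_self hx hy r s)
    simp [h] at this

theorem involutory_relations [CharP F 2] {M : Matrix (Fin 3) (Fin 3) F} (h : M * M = 1) :
    M 0 0 + M 1 1 + M 2 2 = 1 ∧ M.adjugate = M := by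
  have h2 : (2 : F) = 0 := CharTwo.two_eq_zero
  constructor
  · have ht : (M * M).trace = 1 := by
      rw [h]
      simp
      grind
    have hs : (M 0 0 + M 1 1 + M 2 2 - 1) ^ 2 = 0 := by
      simp [Matrix.trace, Matrix.mul_apply, Fin.sum_univ_three] at ht
      grind
    exact sub_eq_zero.1 (pow_eq_zero_iff two_ne_zero |>.1 hs)
  · have hd : (M.det - 1) ^ 2 = 0 := by
      have := congrArg Matrix.det h
      rw [Matrix.det_mul, Matrix.det_one] at this
      grind
    have hd1 : M.det = 1 := sub_eq_zero.1 (pow_eq_zero_iff two_ne_zero |>.1 hd)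
    calc
      M.adjugate = M.adjugate * (M * M) := by rw [h, mul_one]
      _ = M := by rw [← mul_assoc, Matrix.adjugate_mul, hd1, one_smul, one_mul]

theorem involutory_entries [CharP F 2] {M : Matrix (Fin 3) (Fin 3) F} (h : M * M = 1)
    (h₀ : ∀ i j, M i j ≠ 0) :
    ((M 0 0 + 1 ≠ 0 ∧ M 0 0 + 1 ≠ 1) ∧ M 1 1 + 1 ≠ 0 ∧ M 1 1 + 1 ≠ 1 ∧
      M 1 1 + 1 ≠ M 0 0 + 1 ∧ M 1 1 + 1 ≠ M 0 0 + 1 + 1) ∧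
    M 0 1 * M 1 0 = (M 0 0 + 1) * (M 1 1 + 1) ∧ M 0 2 * M 2 0 = (M 0 0 + 1) * (M 2 2 + 1) ∧
    M 0 1 * M 2 0 = (M 0 0 + 1) * M 2 1 ∧ M 0 2 * M 1 0 = (M 0 0 + 1) * M 1 2 := by
  have h2 : (2 : F) = 0 := CharTwo.two_eq_zero
  obtain ⟨ht, ha⟩ := involutory_relations h
  rw [Matrix.adjugate_fin_three] at ha
  have a11 := congrFun₂ ha 1 1
  have a22 := congrFun₂ ha 2 2
  have a12 := congrFun₂ ha 1 2
  have a21 := congrFun₂ ha 2 1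
  simp at a11 a22 a12 a21
  have e₁ : M 0 1 * M 1 0 = (M 0 0 + 1) * (M 1 1 + 1) := by grind
  have e₂ : M 0 2 * M 2 0 = (M 0 0 + 1) * (M 2 2 + 1) := by grind
  have e₃ : M 0 1 * M 2 0 = (M 0 0 + 1) * M 2 1 := by grind
  have e₄ : M 0 2 * M 1 0 = (M 0 0 + 1) * M 1 2 := by grind
  have p₁ := mul_ne_zero (h₀ 0 1) (h₀ 1 0)
  have p₂ := mul_ne_zero (h₀ 0 2) (h₀ 2 0)
  rw [e₁] at p₁
  rw [e₂] at p₂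
  have n₀ := left_ne_zero_of_mul p₁
  have n₁ := right_ne_zero_of_mul p₁
  have n₂ := right_ne_zero_of_mul p₂
  have h00 := h₀ 0 0
  have h11 := h₀ 1 1
  have h22 := h₀ 2 2
  refine ⟨⟨⟨n₀, ?_⟩, n₁, ?_, ?_, ?_⟩, e₁, e₂, e₃, e₄⟩ <;> grind

/-- In characteristic two, the involutory MDS matrices of order three are the matrices
`involution x y r s` with suitable parameters. -/
def involutoryMDSEquiv [CharP F 2] :
    {M : Matrix (Fin 3) (Fin 3) F // IsMDS M ∧ M * M = 1} ≃
      (Fˣ × Fˣ) × {p : F × F // (p.1 ≠ 0 ∧ p.1 ≠ 1) ∧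
        p.2 ≠ 0 ∧ p.2 ≠ 1 ∧ p.2 ≠ p.1 ∧ p.2 ≠ p.1 + 1} where
  toFun M :=
    have h := ((isMDS_fin_three_iff M.1).1 M.2.1).1
    have h' := (involutory_entries M.2.2 h).1
    ((Units.mk0 _ (div_ne_zero (h 1 0) h'.1.1), Units.mk0 _ (div_ne_zero (h 2 0) h'.1.1)),
      ⟨(M.1 0 0 + 1, M.1 1 1 + 1), h'⟩)
  invFun p := ⟨involution p.1.1 p.1.2 p.2.1.1 p.2.1.2,
    isMDS_involution p.1.1.ne_zero p.1.2.ne_zero p.2.2.1.1 p.2.2.1.2 p.2.2.2.1 p.2.2.2.2.1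
      p.2.2.2.2.2.1 p.2.2.2.2.2.2,
    involution_mul_self p.1.1.ne_zero p.1.2.ne_zero _ _⟩
  left_inv := by
    rintro ⟨M, hM, hMM⟩
    have h2 : (2 : F) = 0 := CharTwo.two_eq_zero
    have h := ((isMDS_fin_three_iff M).1 hM).1
    obtain ⟨⟨⟨n₀, -⟩, -⟩, e₁, e₂, e₃, e₄⟩ := involutory_entries hMM h
    have ht := (involutory_relations hMM).1
    have := h 1 0
    have := h 2 0
    ext i j
    fin_cases i <;> fin_cases j <;> simp [involution] <;> field_simp <;> grind
  right_inv := by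
    rintro ⟨⟨x, y⟩, ⟨r, s⟩, ⟨hr₀, hr₁⟩, hs⟩
    have h2 : (2 : F) = 0 := CharTwo.two_eq_zero
    have hr : 1 + r + 1 = r := by linear_combination h2
    have hs : 1 + s + 1 = s := by linear_combination h2
    ext <;> simp [involution, hr, hs, hr₀]

theorem card_involutory_mds_fin_three [Fintype F] [CharP F 2] :
    (Nat.card {M : Matrix (Fin 3) (Fin 3) F // IsMDS M ∧ M * M = 1} : ℤ) =
      ((Fintype.card F : ℤ) - 1) ^ 2 *
        (((Fintype.card F : ℤ) - 2) * ((Fintype.card F : ℤ) - 4)) := by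
  classical
  have h2 : (2 : F) = 0 := CharTwo.two_eq_zero
  let e : {p : F × F // (p.1 ≠ 0 ∧ p.1 ≠ 1) ∧
        p.2 ≠ 0 ∧ p.2 ≠ 1 ∧ p.2 ≠ p.1 ∧ p.2 ≠ p.1 + 1} ≃
      (({0, 1}ᶜ : Finset F).sigma fun r => ({0, 1, r, r + 1}ᶜ : Finset F) :
        Finset ((_ : F) × F)) :=
    { toFun := fun p => ⟨⟨p.1.1, p.1.2⟩, by simpa using p.2⟩
      invFun := fun p => ⟨⟨p.1.1, p.1.2⟩, by simpa using p.2⟩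
      left_inv := fun _ => rfl
      right_inv := fun _ => rfl }
  have hcard : ∀ r ∈ ({0, 1}ᶜ : Finset F),
      (#({0, 1, r, r + 1}ᶜ : Finset F) : ℤ) = Fintype.card F - 4 := by
    intro r hr
    simp only [Finset.mem_compl, Finset.mem_insert, Finset.mem_singleton, not_or] at hr
    have h₁ : r ≠ r + 1 := by simp
    have h₂ : 0 ≠ r + 1 := by grind
    have h₃ : 1 ≠ r + 1 := by grind
    have : #({0, 1, r, r + 1} : Finset F) = 4 := by
      rw [Finset.card_insert_of_notMem,
        Finset.card_eq_three.2 ⟨1, r, r + 1, Ne.symm hr.2, h₃, h₁, rfl⟩]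
      simp [Ne.symm hr.1, h₂]
    rw [card_compl_eq, this]
    norm_num
  rw [Nat.card_congr involutoryMDSEquiv, Nat.card_prod, Nat.card_prod, Nat.card_congr e,
    Nat.card_eq_fintype_card (α := Finset.sigma _ _), Fintype.card_coe, Finset.card_sigma]
  push_cast
  rw [Finset.sum_congr rfl hcard, Finset.sum_const, nsmul_eq_mul, card_compl_pair, card_units_eq]
  ring

end

theorem card_3x3_noninvolutory_mds {F : Type*} [Field F] [Fintype F] (hF : CharP F 2) :
    (Nat.card {M : Matrix (Fin 3) (Fin 3) F // IsMDS M ∧ M * M ≠ 1} : ℤ) =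
      ((Fintype.card F : ℤ) - 1) ^ 2 * ((Fintype.card F : ℤ) - 2) *
        ((Fintype.card F : ℤ) ^ 6 - 15 * (Fintype.card F : ℤ) ^ 5 +
          87 * (Fintype.card F : ℤ) ^ 4 - 244 * (Fintype.card F : ℤ) ^ 3 +
          345 * (Fintype.card F : ℤ) ^ 2 - 238 * (Fintype.card F : ℤ) + 67) := by
  classical
  have hsplit : Nat.card {M : Matrix (Fin 3) (Fin 3) F // IsMDS M} =
      Nat.card {M : Matrix (Fin 3) (Fin 3) F // IsMDS M ∧ M * M = 1} +
        Nat.card {M : Matrix (Fin 3) (Fin 3) F // IsMDS M ∧ M * M ≠ 1} := by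
    simp only [Nat.card_eq_fintype_card, Fintype.card_subtype]
    rw [← Finset.filter_filter, ← Finset.filter_filter, Finset.card_filter_add_card_filter_not]
  have h := congrArg (Nat.cast : ℕ → ℤ) hsplit
  rw [Nat.cast_add, card_mds_fin_three, card_involutory_mds_fin_three] at h
  linear_combination -h
end

section
/- The number of 4×4 MDS matrices over the finite field with 8 elements equals 7⁷ · 720. -/
/-- Nonvanishing of minors may be tested on increasing choices of rows and columns. -/
theorem isMDS_iff_strictMono {F : Type*} [Field F] {n : ℕ} {M : Matrix (Fin n) (Fin n) F} :
    IsMDS M ↔ ∀ (k : ℕ), 1 ≤ k → ∀ (f g : Fin k → Fin n), StrictMono f → StrictMono g →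
      (M.submatrix f g).det ≠ 0 := by
  refine ⟨fun h k hk f g hf hg => h k hk f g hf.injective hg.injective,
    fun h k hk f g hf hg hdet => ?_⟩
  refine h k hk (f ∘ Tuple.sort f) (g ∘ Tuple.sort g)
    ((Tuple.monotone_sort f).strictMono_of_injective (hf.comp (Equiv.injective _)))
    ((Tuple.monotone_sort g).strictMono_of_injective (hg.comp (Equiv.injective _))) ?_
  have : M.submatrix (f ∘ Tuple.sort f) (g ∘ Tuple.sort g) =
      ((M.submatrix f g).submatrix (Tuple.sort f) id).submatrix id (Tuple.sort g) := rfl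
  rw [this, Matrix.det_permute', Matrix.det_permute, hdet, mul_zero, mul_zero]

/-- Scaling rows and columns by units preserves the MDS property. -/
theorem IsMDS.scale {F : Type*} [Field F] {n : ℕ} {M : Matrix (Fin n) (Fin n) F} (h : IsMDS M)
    {u w : Fin n → F} (hu : ∀ i, u i ≠ 0) (hw : ∀ j, w j ≠ 0) :
    IsMDS (Matrix.of fun i j => u i * (w j * M i j)) := by
  intro k hk f g hf hg
  have : (Matrix.of fun i j => u i * (w j * M i j)).submatrix f g =
      Matrix.of fun i j => u (f i) *
        (Matrix.of fun i j => w (g j) * M.submatrix f g i j) i j := rfl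
  rw [this, Matrix.det_mul_column, Matrix.det_mul_row]
  exact mul_ne_zero (Finset.prod_ne_zero_iff.2 fun i _ => hu _)
    (mul_ne_zero (Finset.prod_ne_zero_iff.2 fun j _ => hw _) (h k hk f g hf hg))

theorem IsMDS.apply_ne_zero {F : Type*} [Field F] {n : ℕ} {M : Matrix (Fin n) (Fin n) F}
    (h : IsMDS M) (i j : Fin n) : M i j ≠ 0 := by
  simpa using h 1 le_rfl (fun _ => i) (fun _ => j) (Function.injective_of_subsingleton _)
    (Function.injective_of_subsingleton _)

/-- A ring isomorphism carries MDS matrices to MDS matrices. -/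
theorem isMDS_map_iff {F K : Type*} [Field F] [Field K] (e : F ≃+* K) {n : ℕ}
    (M : Matrix (Fin n) (Fin n) F) : IsMDS (M.map e) ↔ IsMDS M := by
  refine forall₂_congr fun k _ => forall₂_congr fun f g => forall₂_congr fun _ _ => ?_
  rw [Matrix.submatrix_map, ← RingEquiv.mapMatrix_apply, ← RingEquiv.map_det]
  exact map_ne_zero_iff e e.injective

/-- Adjoin a first row and a first column of ones to a matrix. -/
def bordered {F : Type*} [One F] {n : ℕ} (N : Matrix (Fin n) (Fin n) F) :
    Matrix (Fin (n + 1)) (Fin (n + 1)) F :=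
  Matrix.of (Fin.cons 1 fun i => Fin.cons 1 (N i))

section bordered

variable {F : Type*} [One F] {n : ℕ} (N : Matrix (Fin n) (Fin n) F)

@[simp]
theorem bordered_zero (j : Fin (n + 1)) : bordered N 0 j = 1 := rfl

@[simp]
theorem bordered_succ_zero (i : Fin n) : bordered N i.succ 0 = 1 := rfl

@[simp]
theorem bordered_succ_succ (i j : Fin n) : bordered N i.succ j.succ = N i j := rfl

end bordered

/-- The MDS matrices are obtained uniquely from those whose first row and column consist of ones by
scaling all rows, and all columns but the first. -/
def isMDSEquiv (F : Type*) [Field F] (n : ℕ) :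
    {M : Matrix (Fin (n + 1)) (Fin (n + 1)) F // IsMDS M} ≃
      ((Fin (n + 1) → Fˣ) × (Fin n → Fˣ)) ×
        {N : Matrix (Fin n) (Fin n) F // IsMDS (bordered N)} where
  toFun M :=
    ((fun i => Units.mk0 _ (M.2.apply_ne_zero i 0),
      fun j => Units.mk0 _ (div_ne_zero (M.2.apply_ne_zero 0 j.succ) (M.2.apply_ne_zero 0 0))),
      ⟨Matrix.of fun i j =>
        (M.1 i.succ 0)⁻¹ * ((M.1 0 j.succ / M.1 0 0)⁻¹ * M.1 i.succ j.succ), by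
        have hM := M.2.apply_ne_zero
        convert M.2.scale (u := fun i => (M.1 i 0)⁻¹) (w := fun j => (M.1 0 j / M.1 0 0)⁻¹)
          (fun i => inv_ne_zero (hM i 0))
          (fun j => inv_ne_zero (div_ne_zero (hM 0 j) (hM 0 0))) using 1
        ext i j
        have h0 := hM 0 0
        have hi := hM i 0
        have hj := hM 0 j
        cases i using Fin.cases <;> cases j using Fin.cases <;> simp <;> field_simp⟩)
  invFun x := ⟨Matrix.of fun i j => (x.1.1 i : F) *
      ((Fin.cons 1 x.1.2 : Fin (n + 1) → Fˣ) j * bordered x.2.1 i j),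
    x.2.2.scale (fun _ => Units.ne_zero _) (fun _ => Units.ne_zero _)⟩
  left_inv M := by
    ext i j
    have h0 := M.2.apply_ne_zero 0 0
    have hi := M.2.apply_ne_zero i 0
    have hj := M.2.apply_ne_zero 0 j
    cases i using Fin.cases <;> cases j using Fin.cases <;> simp <;> field_simp
  right_inv x := by
    obtain ⟨⟨u, w⟩, N, hN⟩ := x
    refine Prod.ext (Prod.ext ?_ ?_) (Subtype.ext ?_)
    · ext i
      cases i using Fin.cases <;> simp
    · ext j
      simp
    · ext i j
      simp
      field_simp

theorem card_isMDS_succ (F : Type*) [Field F] [Finite F] (n : ℕ) :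
    Nat.card {M : Matrix (Fin (n + 1)) (Fin (n + 1)) F // IsMDS M} =
      (Nat.card F - 1) ^ (2 * n + 1) *
        Nat.card {N : Matrix (Fin n) (Fin n) F // IsMDS (bordered N)} := by
  rw [Nat.card_congr (isMDSEquiv F n), Nat.card_prod, Nat.card_prod, Nat.card_fun, Nat.card_fun,
    Nat.card_units, Nat.card_fin, Nat.card_fin, ← pow_add]
  congr 2
  ring

/-- The field with eight elements; `cₙ` is the polynomial over `ZMod 2` whose coefficients are the
binary digits of `n`, taken modulo `X ^ 3 + X + 1`. -/
inductive GF8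
  | c0 | c1 | c2 | c3 | c4 | c5 | c6 | c7
  deriving DecidableEq

namespace GF8

instance : Fintype GF8 :=
  ⟨{c0, c1, c2, c3, c4, c5, c6, c7}, fun x => by cases x <;> decide⟩

/-- Addition in `GF8`. -/
def add (a b : GF8) : GF8 :=
  match a with
  | c0 => b.casesOn c0 c1 c2 c3 c4 c5 c6 c7
  | c1 => b.casesOn c1 c0 c3 c2 c5 c4 c7 c6
  | c2 => b.casesOn c2 c3 c0 c1 c6 c7 c4 c5
  | c3 => b.casesOn c3 c2 c1 c0 c7 c6 c5 c4
  | c4 => b.casesOn c4 c5 c6 c7 c0 c1 c2 c3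
  | c5 => b.casesOn c5 c4 c7 c6 c1 c0 c3 c2
  | c6 => b.casesOn c6 c7 c4 c5 c2 c3 c0 c1
  | c7 => b.casesOn c7 c6 c5 c4 c3 c2 c1 c0

/-- Multiplication in `GF8`. -/
def mul (a b : GF8) : GF8 :=
  match a with
  | c0 => b.casesOn c0 c0 c0 c0 c0 c0 c0 c0
  | c1 => b.casesOn c0 c1 c2 c3 c4 c5 c6 c7
  | c2 => b.casesOn c0 c2 c4 c6 c3 c1 c7 c5
  | c3 => b.casesOn c0 c3 c6 c5 c7 c4 c1 c2
  | c4 => b.casesOn c0 c4 c3 c7 c6 c2 c5 c1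
  | c5 => b.casesOn c0 c5 c1 c4 c2 c7 c3 c6
  | c6 => b.casesOn c0 c6 c7 c1 c5 c3 c2 c4
  | c7 => b.casesOn c0 c7 c5 c2 c1 c6 c4 c3

/-- Inversion in `GF8`. -/
def inv (b : GF8) : GF8 :=
  b.casesOn c0 c1 c5 c6 c7 c2 c3 c4

instance : Zero GF8 := ⟨c0⟩

instance : One GF8 := ⟨c1⟩

instance : Add GF8 := ⟨add⟩

instance : Mul GF8 := ⟨mul⟩

instance : Neg GF8 := ⟨id⟩

instance : Field GF8 where
  inv := inv
  nsmul := nsmulRec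
  zsmul := zsmulRec
  nnqsmul := _
  qsmul := _
  add_assoc := by decide +kernel
  zero_add := by decide +kernel
  add_zero := by decide +kernel
  add_comm := by decide +kernel
  mul_assoc := by decide +kernel
  one_mul := by decide +kernel
  mul_one := by decide +kernel
  mul_comm := by decide +kernel
  zero_mul := by decide +kernel
  mul_zero := by decide +kernel
  left_distrib := by decide +kernel
  right_distrib := by decide +kernel
  neg_add_cancel := by decide +kernel
  exists_pair_ne := ⟨c0, c1, by decide⟩
  mul_inv_cancel := by decide +kernel
  inv_zero := rfl

/-- Whether an element of `GF8` is nonzero. -/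
def isNonzero (x : GF8) : Bool :=
  x.casesOn false true true true true true true true

/-- The sum of a function over `GF8`, in a form that the kernel evaluates quickly. -/
def total (f : GF8 → ℕ) : ℕ :=
  f c0 + (f c1 + (f c2 + (f c3 + (f c4 + (f c5 + (f c6 + f c7))))))

/-- The 2 × 2 determinant. -/
def detTwo (a b c d : GF8) : GF8 :=
  add (mul a d) (mul b c)

/-- The 3 × 3 determinant. -/
def detThree (a b c d e f g h i : GF8) : GF8 :=
  add (mul a (detTwo e f h i)) (add (mul b (detTwo d f g i)) (mul c (detTwo d e g h)))

/-- The 4 × 4 determinant. -/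
def detFour (a b c d e f g h i j k l m n o p : GF8) : GF8 :=
  add (mul a (detThree f g h j k l n o p)) (add (mul b (detThree e g h i k l m o p))
    (add (mul c (detThree e f h i j l m n p)) (mul d (detThree e f g i j k m n o))))

/-- The minors of the bordered matrix ending at the entry `a` are nonzero. -/
def extendsA (a : GF8) : Bool :=
  isNonzero a &&
    isNonzero (detTwo c1 c1 c1 a)

/-- The minors of the bordered matrix ending at the entry `b` are nonzero. -/
def extendsB (a b : GF8) : Bool :=
  isNonzero b &&
    isNonzero (detTwo c1 c1 c1 b) &&
    isNonzero (detTwo c1 c1 a b)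

/-- The minors of the bordered matrix ending at the entry `c` are nonzero. -/
def extendsC (a b c : GF8) : Bool :=
  isNonzero c &&
    isNonzero (detTwo c1 c1 c1 c) &&
    isNonzero (detTwo c1 c1 a c) &&
    isNonzero (detTwo c1 c1 b c)

/-- The minors of the bordered matrix ending at the entry `d` are nonzero. -/
def extendsD (a d : GF8) : Bool :=
  isNonzero d &&
    isNonzero (detTwo c1 c1 c1 d) &&
    isNonzero (detTwo c1 a c1 d)

/-- The minors of the bordered matrix ending at the entry `e` are nonzero. -/
def extendsE (a b d e : GF8) : Bool :=
  isNonzero e &&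
    isNonzero (detTwo c1 c1 c1 e) &&
    isNonzero (detTwo c1 c1 d e) &&
    isNonzero (detTwo c1 b c1 e) &&
    isNonzero (detTwo a b d e) &&
    isNonzero (detThree c1 c1 c1 c1 a b c1 d e)

/-- The minors of the bordered matrix ending at the entry `f` are nonzero. -/
def extendsF (a b c d e f : GF8) : Bool :=
  isNonzero f &&
    isNonzero (detTwo c1 c1 c1 f) &&
    isNonzero (detTwo c1 c1 d f) &&
    isNonzero (detTwo c1 c1 e f) &&
    isNonzero (detTwo c1 c c1 f) &&
    isNonzero (detTwo a c d f) &&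
    isNonzero (detTwo b c e f) &&
    isNonzero (detThree c1 c1 c1 c1 a c c1 d f) &&
    isNonzero (detThree c1 c1 c1 c1 b c c1 e f) &&
    isNonzero (detThree c1 c1 c1 a b c d e f)

/-- The minors of the bordered matrix ending at the entry `g` are nonzero. -/
def extendsG (a d g : GF8) : Bool :=
  isNonzero g &&
    isNonzero (detTwo c1 c1 c1 g) &&
    isNonzero (detTwo c1 a c1 g) &&
    isNonzero (detTwo c1 d c1 g)

/-- The minors of the bordered matrix ending at the entry `h` are nonzero. -/
def extendsH (a b d e g h : GF8) : Bool :=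
  isNonzero h &&
    isNonzero (detTwo c1 c1 c1 h) &&
    isNonzero (detTwo c1 c1 g h) &&
    isNonzero (detTwo c1 b c1 h) &&
    isNonzero (detTwo a b g h) &&
    isNonzero (detTwo c1 e c1 h) &&
    isNonzero (detTwo d e g h) &&
    isNonzero (detThree c1 c1 c1 c1 a b c1 g h) &&
    isNonzero (detThree c1 c1 c1 c1 d e c1 g h) &&
    isNonzero (detThree c1 a b c1 d e c1 g h)

/-- The minors of the bordered matrix ending at the entry `i` are nonzero. -/
def extendsI (a b c d e f g h i : GF8) : Bool :=
  isNonzero i &&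
    isNonzero (detTwo c1 c1 c1 i) &&
    isNonzero (detTwo c1 c1 g i) &&
    isNonzero (detTwo c1 c1 h i) &&
    isNonzero (detTwo c1 c c1 i) &&
    isNonzero (detTwo a c g i) &&
    isNonzero (detTwo b c h i) &&
    isNonzero (detTwo c1 f c1 i) &&
    isNonzero (detTwo d f g i) &&
    isNonzero (detTwo e f h i) &&
    isNonzero (detThree c1 c1 c1 c1 a c c1 g i) &&
    isNonzero (detThree c1 c1 c1 c1 b c c1 h i) &&
    isNonzero (detThree c1 c1 c1 a b c g h i) &&
    isNonzero (detThree c1 c1 c1 c1 d f c1 g i) &&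
    isNonzero (detThree c1 c1 c1 c1 e f c1 h i) &&
    isNonzero (detThree c1 c1 c1 d e f g h i) &&
    isNonzero (detThree c1 a c c1 d f c1 g i) &&
    isNonzero (detThree c1 b c c1 e f c1 h i) &&
    isNonzero (detThree a b c d e f g h i) &&
    isNonzero (detFour c1 c1 c1 c1 c1 a b c c1 d e f c1 g h i)

/-- The number of 3 × 3 matrices over `GF8` whose bordered matrix is MDS, by pruned search. -/
def searchCount : ℕ :=
  total fun a => cond (extendsA a) (
  total fun b => cond (extendsB a b) (
  total fun c => cond (extendsC a b c) (
  total fun d => cond (extendsD a d) (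
  total fun e => cond (extendsE a b d e) (
  total fun f => cond (extendsF a b c d e f) (
  total fun g => cond (extendsG a d g) (
  total fun h => cond (extendsH a b d e g h) (
  total fun i => cond (extendsI a b c d e f g h i) 1 0) 0) 0) 0) 0) 0) 0) 0) 0

theorem searchCount_eq : searchCount = 720 := by
  decide +kernel

theorem isNonzero_iff {x : GF8} : isNonzero x = true ↔ x ≠ 0 := by
  revert x
  decide

theorem total_eq_sum (f : GF8 → ℕ) : total f = ∑ x, f x := by
  rw [total]
  rfl

theorem neg_eq (x : GF8) : -x = x := rfl

theorem det_eq_detTwo (M : Matrix (Fin 2) (Fin 2) GF8) :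
    M.det = detTwo (M 0 0) (M 0 1) (M 1 0) (M 1 1) :=
  M.det_fin_two

theorem det_eq_detThree (M : Matrix (Fin 3) (Fin 3) GF8) :
    M.det = detThree (M 0 0) (M 0 1) (M 0 2) (M 1 0) (M 1 1) (M 1 2) (M 2 0) (M 2 1) (M 2 2) := by
  change _ = M 0 0 * (M 1 1 * M 2 2 + M 1 2 * M 2 1) +
    (M 0 1 * (M 1 0 * M 2 2 + M 1 2 * M 2 0) + M 0 2 * (M 1 0 * M 2 1 + M 1 1 * M 2 0))
  simp only [Matrix.det_fin_three, sub_eq_add_neg, neg_eq]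
  ring

theorem det_eq_detFour (M : Matrix (Fin 4) (Fin 4) GF8) :
    M.det = detFour (M 0 0) (M 0 1) (M 0 2) (M 0 3) (M 1 0) (M 1 1) (M 1 2) (M 1 3)
      (M 2 0) (M 2 1) (M 2 2) (M 2 3) (M 3 0) (M 3 1) (M 3 2) (M 3 3) := by
  have h (i : ℕ) : (-1 : GF8) ^ i = 1 := by rw [neg_eq, one_pow]
  simp only [Matrix.det_succ_row_zero M, Fin.sum_univ_four, h, one_mul, det_eq_detThree, add_assoc]
  rfl

/-- The MDS property of a 4 × 4 matrix, one size of minors at a time. -/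
theorem isMDS_iff (M : Matrix (Fin 4) (Fin 4) GF8) :
    IsMDS M ↔ (∀ i j, isNonzero (M i j)) ∧
      (∀ i₁ i₂, i₁ < i₂ → ∀ j₁ j₂, j₁ < j₂ →
        isNonzero (detTwo (M i₁ j₁) (M i₁ j₂) (M i₂ j₁) (M i₂ j₂))) ∧
      (∀ i₁ i₂ i₃, i₁ < i₂ → i₂ < i₃ → ∀ j₁ j₂ j₃, j₁ < j₂ → j₂ < j₃ →
        isNonzero (detThree (M i₁ j₁) (M i₁ j₂) (M i₁ j₃) (M i₂ j₁) (M i₂ j₂) (M i₂ j₃)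
          (M i₃ j₁) (M i₃ j₂) (M i₃ j₃))) ∧
      isNonzero (detFour (M 0 0) (M 0 1) (M 0 2) (M 0 3) (M 1 0) (M 1 1) (M 1 2) (M 1 3)
        (M 2 0) (M 2 1) (M 2 2) (M 2 3) (M 3 0) (M 3 1) (M 3 2) (M 3 3)) := by
  simp only [isNonzero_iff, ← det_eq_detFour]
  have hid (f : Fin 4 → Fin 4) (hf : StrictMono f) : f = id := by
    revert f
    decide +kernel
  rw [isMDS_iff_strictMono]
  constructor
  · intro h
    refine ⟨fun i j => ?_, fun i₁ i₂ hi j₁ j₂ hj => ?_,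
      fun i₁ i₂ i₃ hi hi' j₁ j₂ j₃ hj hj' => ?_, h 4 (by decide) id id strictMono_id strictMono_id⟩
    · simpa using h 1 le_rfl (fun _ => i) (fun _ => j) (Subsingleton.strictMono _)
        (Subsingleton.strictMono _)
    · have := h 2 (by decide) ![i₁, i₂] ![j₁, j₂] (by simpa) (by simpa)
      rwa [det_eq_detTwo] at this
    · have := h 3 (by decide) ![i₁, i₂, i₃] ![j₁, j₂, j₃] (by simp [*]) (by simp [*])
      rwa [det_eq_detThree] at this
  · rintro ⟨h1, h2, h3, h4⟩ k hk f g hf hg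
    have hk4 : k ≤ 4 := by simpa using Fintype.card_le_of_injective f hf.injective
    interval_cases k
    · simpa using h1 (f 0) (g 0)
    · rw [det_eq_detTwo]
      exact h2 _ _ (hf (by decide)) _ _ (hg (by decide))
    · rw [det_eq_detThree]
      exact h3 _ _ _ (hf (by decide)) (hf (by decide)) _ _ _ (hg (by decide)) (hg (by decide))
    · rw [hid f hf, hid g hg]
      exact h4

theorem forall_fin_four {p : Fin 4 → Prop} : (∀ i, p i) ↔ p 0 ∧ p 1 ∧ p 2 ∧ p 3 := by
  simp [Fin.forall_fin_succ]

theorem forall_lt_fin_four {p : Fin 4 → Fin 4 → Prop} :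
    (∀ i j, i < j → p i j) ↔ p 0 1 ∧ p 0 2 ∧ p 0 3 ∧ p 1 2 ∧ p 1 3 ∧ p 2 3 := by
  simp [forall_fin_four, and_assoc]

theorem forall_lt_lt_fin_four {p : Fin 4 → Fin 4 → Fin 4 → Prop} :
    (∀ i j k, i < j → j < k → p i j k) ↔ p 0 1 2 ∧ p 0 1 3 ∧ p 0 2 3 ∧ p 1 2 3 := by
  simp [forall_fin_four, and_assoc]

theorem bordered_eq (a b c d e f g h i : GF8) :
    bordered !![a, b, c; d, e, f; g, h, i] =
      !![c1, c1, c1, c1; c1, a, b, c; c1, d, e, f; c1, g, h, i] := by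
  ext i j
  fin_cases i <;> fin_cases j <;> rfl

theorem isMDS_bordered_iff (a b c d e f g h i : GF8) :
    IsMDS (bordered !![a, b, c; d, e, f; g, h, i]) ↔
      extendsA a ∧ extendsB a b ∧ extendsC a b c ∧ extendsD a d ∧ extendsE a b d e ∧
        extendsF a b c d e f ∧ extendsG a d g ∧ extendsH a b d e g h ∧
        extendsI a b c d e f g h i := by
  have hone : isNonzero c1 = true := rfl
  rw [isMDS_iff, bordered_eq]
  simp only [forall_lt_lt_fin_four]
  simp only [forall_lt_fin_four]
  simp only [forall_fin_four, Matrix.of_apply, Matrix.cons_val, extendsA, extendsB, extendsC,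
    extendsD, extendsE, extendsF, extendsG, extendsH, extendsI, Bool.and_eq_true]
  constructor <;> intro h <;> simp only [h, hone, and_self]

/-- A 3 × 3 matrix is the same as its list of entries. -/
def matrixEquiv :
    GF8 × GF8 × GF8 × GF8 × GF8 × GF8 × GF8 × GF8 × GF8 ≃ Matrix (Fin 3) (Fin 3) GF8 where
  toFun | (a, b, c, d, e, f, g, h, i) => !![a, b, c; d, e, f; g, h, i]
  invFun N := (N 0 0, N 0 1, N 0 2, N 1 0, N 1 1, N 1 2, N 2 0, N 2 1, N 2 2)
  left_inv _ := rfl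
  right_inv N := (Matrix.eta_fin_three N).symm

theorem cond_total (p : Bool) (f : GF8 → ℕ) :
    cond p (total f) 0 = total fun x => cond p (f x) 0 := by
  cases p <;> rfl

theorem cond_cond (p q : Bool) (n : ℕ) : cond p (cond q n 0) 0 = cond (p && q) n 0 := by
  cases p <;> rfl

theorem card_bordered :
    Nat.card {N : Matrix (Fin 3) (Fin 3) GF8 // IsMDS (bordered N)} = 720 := by
  classical
  rw [← searchCount_eq, Nat.card_eq_fintype_card, Fintype.card_subtype, Finset.card_filter,
    ← Equiv.sum_comp matrixEquiv]
  simp only [Fintype.sum_prod_type, searchCount, cond_total, cond_cond]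
  simp only [total_eq_sum]
  iterate 9 refine Finset.sum_congr rfl fun _ _ => ?_
  rw [Bool.cond_eq_ite]
  refine if_congr ((isMDS_bordered_iff ..).trans ?_) rfl rfl
  simp only [Bool.and_eq_true]

end GF8

theorem card_4x4_mds_over_gf8 :
    Nat.card {M : Matrix (Fin 4) (Fin 4) (GaloisField 2 3) // IsMDS M} = 7 ^ 7 * 720 := by
  have hcard : Nat.card GF8 = 8 := by
    rw [Nat.card_eq_fintype_card]
    rfl
  have : Fintype (GaloisField 2 3) := Fintype.ofFinite _
  let e : GaloisField 2 3 ≃+* GF8 := FiniteField.ringEquivOfCardEq <| by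
    rw [← Nat.card_eq_fintype_card, ← Nat.card_eq_fintype_card, hcard,
      GaloisField.card 2 3 (by decide)]
    rfl
  rw [Nat.card_congr (e.toEquiv.mapMatrix.subtypeEquiv fun M => (isMDS_map_iff e M).symm),
    card_isMDS_succ, GF8.card_bordered, hcard]
end
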